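/- Fix subspaces x₁ ∈ X_{r₁}, x₂ ∈ X_{r₂} of an n-dimensional F_q-vector space with ∂(x₂,x₁) = t. Then |{y ∈ X_{r₂} : ∂(y,x₂) = 1 and ∂(y,x₁) = t-1}| = q^{r₁-r₂}(q^t - 1)(q^t - q^{r₂-r₁})/(q-1)². -/

import Mathlib

open Module in
theorem cc_lines (K V : Type*) [Field K] [Fintype K] [AddCommGroup V] [Module K V]
    [FiniteDimensional K V] :
    (Nat.card {H : Submodule K V // finrank K H = 1} : ℚ) * ((Fintype.card K : ℚ) - 1)
      = (Fintype.card K : ℚ) ^ (finrank K V) - 1 := by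
  have : Finite V := Module.finite_of_finite K
  rw [← Nat.card_congr (Projectivization.equivSubmodule K V)]
  have h := Projectivization.card' K V
  have h2 : Nat.card V = Fintype.card K ^ finrank K V := by
    rw [Module.natCard_eq_pow_finrank (K := K), Nat.card_eq_fintype_card]
  rw [h2, Nat.card_eq_fintype_card (α := K)] at h
  have h3 : 1 ≤ Fintype.card K := Fintype.card_pos
  have h4 := congrArg (Nat.cast : ℕ → ℚ) h
  push_cast [Nat.cast_sub h3] at h4
  linarith

open Module in
theorem cc_hyper (K V : Type*) [Field K] [Fintype K] [AddCommGroup V] [Module K V]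
    [FiniteDimensional K V] :
    (Nat.card {H : Submodule K V // finrank K H + 1 = finrank K V} : ℚ)
      * ((Fintype.card K : ℚ) - 1)
      = (Fintype.card K : ℚ) ^ (finrank K V) - 1 := by
  have h := cc_lines K (Dual K V)
  rw [Subspace.dual_finrank_eq] at h
  rw [← h]
  congr 2
  refine Nat.card_congr (Equiv.subtypeEquiv
    ((Subspace.orderIsoFiniteDimensional (K := K) (V := V)).toEquiv.trans OrderDual.ofDual) ?_)
  intro W
  have h1 := Subspace.finrank_add_finrank_dualAnnihilator_eq W
  change _ ↔ finrank K W.dualAnnihilator = 1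
  omega

open Module in
theorem cc_interval (K V : Type*) [Field K] [AddCommGroup V] [Module K V]
    [FiniteDimensional K V] (W X : Submodule K V) (hWX : W ≤ X) (P : ℕ → Prop) :
    Nat.card {l : Submodule K V // (W ≤ l ∧ l ≤ X) ∧ P (finrank K l)}
      = Nat.card {H : Submodule K (X ⧸ W.comap X.subtype) // P (finrank K H + finrank K W)} := by
  have hW : finrank K (W.comap X.subtype) = finrank K W := by
    rw [← Submodule.finrank_map_subtype_eq, Submodule.map_comap_subtype, inf_eq_right.2 hWX]
  set W' := W.comap X.subtype with hW'
  have hfr : ∀ H : Submodule K (X ⧸ W'),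
      finrank K ((H.comap W'.mkQ).map X.subtype) = finrank K H + finrank K W := by
    intro H
    rw [Submodule.finrank_map_subtype_eq]
    have hle : W' ≤ H.comap W'.mkQ := Submodule.le_comap_mkQ W' H
    have e := (Submodule.quotientQuotientEquivQuotient W' (H.comap W'.mkQ) hle).finrank_eq
    rw [Submodule.map_comap_eq_of_surjective W'.mkQ_surjective] at e
    have a1 := Submodule.finrank_quotient_add_finrank (H.comap W'.mkQ)
    have a2 := Submodule.finrank_quotient_add_finrank H
    have a3 := Submodule.finrank_quotient_add_finrank W'
    omega
  symm
  refine Nat.card_eq_of_bijective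
    (fun H => ⟨(H.1.comap W'.mkQ).map X.subtype, ⟨?_, Submodule.map_subtype_le _ _⟩, ?_⟩) ⟨?_, ?_⟩
  · have hle : W' ≤ H.1.comap W'.mkQ := Submodule.le_comap_mkQ W' H.1
    have := Submodule.map_mono (f := X.subtype) hle
    have e : W'.map X.subtype = W := by
      rw [hW', Submodule.map_comap_subtype, inf_eq_right.2 hWX]
    exact e.symm.le.trans this
  · rw [hfr]; exact H.2
  · intro H H' h
    have h1 := congrArg Subtype.val h
    exact Subtype.ext (Submodule.comap_injective_of_surjective W'.mkQ_surjective
      (Submodule.map_injective_of_injective X.injective_subtype h1))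
  · rintro ⟨l, ⟨h1, h2⟩, h3⟩
    have key : (((l.comap X.subtype).map W'.mkQ).comap W'.mkQ).map X.subtype = l := by
      rw [Submodule.comap_map_mkQ, sup_eq_right.2 (Submodule.comap_mono h1),
        Submodule.map_comap_subtype, inf_eq_right.2 h2]
    refine ⟨⟨(l.comap X.subtype).map W'.mkQ, ?_⟩, Subtype.ext key⟩
    rw [← hfr, key]; exact h3

open Module in
theorem cc_bij (K V : Type*) [Field K] [AddCommGroup V] [Module K V]
    [FiniteDimensional K V] (x₁ x₂ : Submodule K V) (t : ℕ)
    (ht : finrank K (x₂ ⊓ x₁ : Submodule K V) + t = finrank K x₂) :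
    Nat.card {y : Submodule K V // finrank K y = finrank K x₂ ∧
        finrank K (y ⊓ x₂ : Submodule K V) + 1 = finrank K x₂ ∧
        finrank K (y ⊓ x₁ : Submodule K V) + t = finrank K x₂ + 1}
      = Nat.card {h : Submodule K V // (x₂ ⊓ x₁ ≤ h ∧ h ≤ x₂) ∧ finrank K h + 1 = finrank K x₂}
        * Nat.card {l : Submodule K V // (x₂ ⊓ x₁ ≤ l ∧ l ≤ x₁) ∧
            finrank K l = finrank K (x₂ ⊓ x₁ : Submodule K V) + 1} := by
  rw [← Nat.card_prod]
  have main : ∀ y : Submodule K V, finrank K y = finrank K x₂ →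
        finrank K (y ⊓ x₂ : Submodule K V) + 1 = finrank K x₂ →
        finrank K (y ⊓ x₁ : Submodule K V) + t = finrank K x₂ + 1 →
        x₂ ⊓ x₁ ≤ y ∧ (y ⊓ x₂) ⊔ (y ⊓ x₁) = y := by
    intro y h1 h2 h3
    have e := Submodule.finrank_sup_add_finrank_inf_eq (y ⊓ x₂) (y ⊓ x₁)
    have e1 : (y ⊓ x₂) ⊓ (y ⊓ x₁) = y ⊓ (x₂ ⊓ x₁) := by rw [← inf_inf_distrib_left]
    rw [e1] at e
    have hs : (y ⊓ x₂) ⊔ (y ⊓ x₁) ≤ y := sup_le inf_le_left inf_le_left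
    have hs' := Submodule.finrank_mono hs
    have hi : y ⊓ (x₂ ⊓ x₁) ≤ x₂ ⊓ x₁ := inf_le_right
    have hi' := Submodule.finrank_mono hi
    refine ⟨?_, Submodule.eq_of_le_of_finrank_le hs (by omega)⟩
    exact inf_eq_right.1 (Submodule.eq_of_le_of_finrank_le hi (by omega))
  refine Nat.card_eq_of_bijective (fun y =>
    (⟨y.1 ⊓ x₂, ⟨le_inf (main y.1 y.2.1 y.2.2.1 y.2.2.2).1 inf_le_left, inf_le_right⟩, y.2.2.1⟩,
     ⟨y.1 ⊓ x₁, ⟨le_inf (main y.1 y.2.1 y.2.2.1 y.2.2.2).1 inf_le_right, inf_le_right⟩, by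
        have := y.2.2.2; omega⟩)) ⟨?_, ?_⟩
  · intro y y' h
    have ha : y.1 ⊓ x₂ = y'.1 ⊓ x₂ := congrArg (fun p => p.1.1) h
    have hb : y.1 ⊓ x₁ = y'.1 ⊓ x₁ := congrArg (fun p => p.2.1) h
    apply Subtype.ext
    rw [← (main y.1 y.2.1 y.2.2.1 y.2.2.2).2, ← (main y'.1 y'.2.1 y'.2.2.1 y'.2.2.2).2, ha, hb]
  · rintro ⟨⟨h, ⟨h1, h2⟩, h3⟩, ⟨l, ⟨l1, l2⟩, l3⟩⟩
    have e2 : (h ⊔ l) ⊓ x₂ = h := by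
      rw [sup_inf_assoc_of_le _ h2]
      exact sup_eq_left.2 ((le_inf inf_le_right (inf_le_left.trans l2)).trans h1)
    have e1 : (h ⊔ l) ⊓ x₁ = l := by
      rw [sup_comm, sup_inf_assoc_of_le _ l2]
      exact sup_eq_left.2 ((le_inf (inf_le_left.trans h2) inf_le_right).trans l1)
    have e3 : h ⊓ l = x₂ ⊓ x₁ := le_antisymm (inf_le_inf h2 l2) (le_inf h1 l1)
    have e := Submodule.finrank_sup_add_finrank_inf_eq h l
    rw [e3] at e
    refine ⟨⟨h ⊔ l, by omega, by rw [e2]; exact h3, by rw [e1]; omega⟩, ?_⟩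
    exact Prod.ext (Subtype.ext e2) (Subtype.ext e1)

/-- Given `x₁ ∈ X_{r₁}`, `x₂ ∈ X_{r₂}` with `∂(x₂,x₁) = t` in an `n`-dimensional
`F_q`-vector space, the number of `y ∈ X_{r₂}` with `∂(y,x₂) = 1` and `∂(y,x₁) = t-1`
equals `q^{r₁-r₂}(q^t - 1)(q^t - q^{r₂-r₁})/(q-1)²`. -/
theorem count_c (q n r₁ r₂ t : ℕ) (K : Type*) [Field K] [Fintype K]
    (hq : Fintype.card K = q)
    (Ω : Type*) [AddCommGroup Ω] [Module K Ω] [FiniteDimensional K Ω]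
    (hn : Module.finrank K Ω = n)
    (x₁ x₂ : Submodule K Ω)
    (h1 : Module.finrank K x₁ = r₁) (h2 : Module.finrank K x₂ = r₂)
    (ht : Module.finrank K (x₂ ⊓ x₁ : Submodule K Ω) + t = r₂) :
    (Nat.card {y : Submodule K Ω // Module.finrank K y = r₂ ∧
        Module.finrank K (y ⊓ x₂ : Submodule K Ω) + 1 = r₂ ∧
        Module.finrank K (y ⊓ x₁ : Submodule K Ω) + t = r₂ + 1} : ℚ) =
      (q : ℚ) ^ ((r₁ : ℤ) - r₂) *
        ((q : ℚ) ^ (t : ℤ) - 1) *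
        ((q : ℚ) ^ (t : ℤ) - (q : ℚ) ^ ((r₂ : ℤ) - r₁)) / ((q : ℚ) - 1) ^ 2 := by
  subst hq h1 h2 hn
  rw [cc_bij K Ω x₁ x₂ t ht]
  have hd : ∀ X : Submodule K Ω, x₂ ⊓ x₁ ≤ X →
      Module.finrank K (X ⧸ (x₂ ⊓ x₁).comap X.subtype)
        + Module.finrank K (x₂ ⊓ x₁ : Submodule K Ω) = Module.finrank K X := by
    intro X hX
    have := Submodule.finrank_quotient_add_finrank ((x₂ ⊓ x₁).comap X.subtype)
    rwa [← Submodule.finrank_map_subtype_eq X, Submodule.map_comap_subtype,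
      inf_eq_right.2 hX] at this
  have d1 := hd x₁ inf_le_right
  have d2 := hd x₂ inf_le_left
  have c2 := cc_interval K Ω (x₂ ⊓ x₁) x₂ inf_le_left (fun m => m + 1 = Module.finrank K x₂)
  have c1 := cc_interval K Ω (x₂ ⊓ x₁) x₁ inf_le_right
    (fun m => m = Module.finrank K (x₂ ⊓ x₁ : Submodule K Ω) + 1)
  have k1 := cc_lines K (x₁ ⧸ (x₂ ⊓ x₁).comap x₁.subtype)
  have k2 := cc_hyper K (x₂ ⧸ (x₂ ⊓ x₁).comap x₂.subtype)
  have f1 : Nat.card {H : Submodule K (x₁ ⧸ (x₂ ⊓ x₁).comap x₁.subtype) //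
      Module.finrank K H = 1} = _ := (Nat.card_congr (Equiv.subtypeEquivRight
        (fun H => by omega))).trans c1.symm
  have f2 : Nat.card {H : Submodule K (x₂ ⧸ (x₂ ⊓ x₁).comap x₂.subtype) //
      Module.finrank K H + 1 = Module.finrank K (x₂ ⧸ (x₂ ⊓ x₁).comap x₂.subtype)} = _ :=
    (Nat.card_congr (Equiv.subtypeEquivRight (fun H => by omega))).trans c2.symm
  rw [f1] at k1
  rw [f2] at k2
  have ht2 : Module.finrank K (x₂ ⧸ (x₂ ⊓ x₁).comap x₂.subtype) = t := by omega
  rw [ht2] at k2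
  have hq1 : (1 : ℚ) < (Fintype.card K : ℚ) := by exact_mod_cast Fintype.one_lt_card
  have hq0 : (Fintype.card K : ℚ) ≠ 0 := by linarith
  have hq2 : (Fintype.card K : ℚ) - 1 ≠ 0 := by linarith
  have z : (Fintype.card K : ℚ) ^ ((Module.finrank K x₁ : ℤ) - Module.finrank K x₂) *
      ((Fintype.card K : ℚ) ^ (t : ℤ)
        - (Fintype.card K : ℚ) ^ ((Module.finrank K x₂ : ℤ) - Module.finrank K x₁))
      = (Fintype.card K : ℚ) ^ Module.finrank K (x₁ ⧸ (x₂ ⊓ x₁).comap x₁.subtype) - 1 := by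
    rw [mul_sub, ← zpow_add₀ hq0, ← zpow_add₀ hq0, ← zpow_natCast (_ : ℚ)
      (Module.finrank K (x₁ ⧸ (x₂ ⊓ x₁).comap x₁.subtype))]
    congr 1
    · congr 1; omega
    · rw [show ((Module.finrank K x₁ : ℤ) - Module.finrank K x₂
        + ((Module.finrank K x₂ : ℤ) - Module.finrank K x₁)) = 0 by ring, zpow_zero]
  rw [mul_right_comm, z, ← k1, zpow_natCast, ← k2, eq_div_iff (pow_ne_zero 2 hq2)]
  push_cast
  ring
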